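/- Let G be a finite connected simple graph and let T₁ and T₂ be spanning trees of G. Then there is a bijection σ from the edge set of T₁ to the edge set of T₂ which fixes every edge lying in both T₁ and T₂, and such that for every edge e of T₁ the spanning subgraph of G with edge set (E(T₁) ∖ {e}) ∪ {σ(e)} is again a spanning tree of G (equivalently, σ(e) connects the two components of T₁ − e). -/

import Mathlib

namespace SimpleGraph

variable {V : Type*} {T T₁ T₂ : SimpleGraph V}

/-- In an acyclic graph, vertices that stay connected after deleting any single edge of `A`
stay connected after deleting all of `A`. -/
theorem IsAcyclic.reachable_deleteEdges (hT : T.IsAcyclic) {A : Set (Sym2 V)} {u v : V}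
    (huv : T.Reachable u v) (h : ∀ e ∈ A, (T.deleteEdges {e}).Reachable u v) :
    (T.deleteEdges A).Reachable u v := by
  classical
  obtain ⟨p, hp⟩ := huv.exists_isPath
  refine ⟨p.toDeleteEdges A fun e hep heA => ?_⟩
  obtain ⟨q, hq⟩ := (h e heA).exists_isPath
  have hle := T.deleteEdges_le {e}
  have hpq : p = q.mapLe hle :=
    congrArg Subtype.val ((hT.subsingleton_path u v).elim ⟨p, hp⟩ ⟨q.mapLe hle, hq.mapLe hle⟩)
  rw [hpq, Walk.edges_mapLe_eq_edges] at hep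
  have := q.edges_subset_edgeSet hep
  simp at this

/-- A finite acyclic graph with the number of edges of a tree is a tree. -/
theorem IsAcyclic.isTree_of_ncard_edgeSet [Finite V] [Nonempty V] (hT : T.IsAcyclic)
    (hcard : T.edgeSet.ncard + 1 = Nat.card V) : T.IsTree := by
  obtain ⟨T', hle, -, hT'⟩ := connected_top.exists_isTree_le_of_le_of_isAcyclic le_top hT
  have hcard' := (isTree_iff_connected_and_card.mp hT').2
  rw [Nat.card_coe_set_eq] at hcard'
  have : T.edgeSet = T'.edgeSet :=
    Set.eq_of_subset_of_ncard_le (edgeSet_mono hle) (by lia) (Set.toFinite _)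
  rwa [edgeSet_injective this]

/-- If the ends of `s(u, v)` lie in different components of `T - e`, exchanging `e` for `s(u, v)`
in the tree `T` yields a tree. -/
theorem IsTree.exchange [Finite V] (hT : T.IsTree) {e : Sym2 V} (he : e ∈ T.edgeSet) {u v : V}
    (h : ¬(T.deleteEdges {e}).Reachable u v) :
    (fromEdgeSet (T.edgeSet \ {e} ∪ {s(u, v)})).IsTree := by
  have := hT.1.nonempty
  have huv : u ≠ v := fun huv => h (huv ▸ Reachable.refl u)
  have hnot : s(u, v) ∉ T.edgeSet \ {e} := fun hmem =>
    h (Adj.reachable (by simpa [deleteEdges_adj] using hmem))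
  have hset : (fromEdgeSet (T.edgeSet \ {e} ∪ {s(u, v)})).edgeSet =
      insert s(u, v) (T.edgeSet \ {e}) := by
    rw [edgeSet_fromEdgeSet, Set.union_singleton, sdiff_eq_left, Set.disjoint_left]
    rintro x (rfl | hx)
    · simpa using huv
    · exact T.not_isDiag_of_mem_edgeSet hx.1
  have hgraph : fromEdgeSet (T.edgeSet \ {e} ∪ {s(u, v)}) = T.deleteEdges {e} ⊔ edge u v := by
    apply edgeSet_injective
    rw [hset, edgeSet_sup, edgeSet_deleteEdges, edgeSet_edge_of_ne huv, Set.union_singleton]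
  apply IsAcyclic.isTree_of_ncard_edgeSet
  · rw [hgraph]
    exact (hT.2.anti (T.deleteEdges_le {e})).sup_edge_of_not_reachable h
  · rw [hset, Set.ncard_insert_of_notMem hnot (Set.toFinite _),
      Set.ncard_sdiff_singleton_add_one he (Set.toFinite _), ← Nat.card_coe_set_eq]
    exact (isTree_iff_connected_and_card.mp hT).2

/-- Hall's condition for the exchange relation between the edges of two trees. -/
theorem IsTree.ncard_le_ncard_exchange [Finite V] (hT₁ : T₁.IsTree) (hT₂ : T₂.IsTree)
    {A : Set (Sym2 V)} (hA : A ⊆ T₁.edgeSet) :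
    A.ncard ≤ {f ∈ T₂.edgeSet |
      ∃ e ∈ A, (fromEdgeSet (T₁.edgeSet \ {e} ∪ {f})).IsTree}.ncard := by
  set N := {f ∈ T₂.edgeSet | ∃ e ∈ A, (fromEdgeSet (T₁.edgeSet \ {e} ∪ {f})).IsTree}
  have := hT₁.1.nonempty
  let H := fromEdgeSet (T₁.edgeSet \ A ∪ N)
  have hadj {u v : V} (huv : T₂.Adj u v) : H.Reachable u v := by
    by_cases hN : s(u, v) ∈ N
    · exact Adj.reachable ((fromEdgeSet_adj _).mpr ⟨Or.inr hN, huv.ne⟩)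
    · have hred : (T₁.deleteEdges A).Reachable u v := by
        refine hT₁.2.reachable_deleteEdges (hT₁.1 u v) fun e he => ?_
        by_contra h
        exact hN ⟨huv, e, he, hT₁.exchange (hA he) h⟩
      refine hred.mono fun x y hxy => ?_
      rw [deleteEdges_adj] at hxy
      exact (fromEdgeSet_adj _).mpr ⟨Or.inl hxy, hxy.1.ne⟩
  have hwalk {u v : V} (p : T₂.Walk u v) : H.Reachable u v := by
    induction p with
    | nil => exact Reachable.refl _
    | cons h _ ih => exact (hadj h).trans ih
  have hH : H.Connected := ⟨fun u v => (hT₂.1 u v).elim hwalk⟩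
  have hHcard := hH.card_vert_le_card_edgeSet_add_one
  have hcard := (isTree_iff_connected_and_card.mp hT₁).2
  rw [Nat.card_coe_set_eq] at hHcard hcard
  have hle : H.edgeSet.ncard ≤ (T₁.edgeSet \ A ∪ N).ncard :=
    Set.ncard_le_ncard (by rw [edgeSet_fromEdgeSet]; exact Set.sdiff_subset) (Set.toFinite _)
  have hunion := Set.ncard_union_le (T₁.edgeSet \ A) N
  have hdiff := Set.ncard_sdiff_add_ncard_of_subset hA (Set.toFinite _)
  lia

/-- An edge of a tree can only be exchanged in for itself. -/
theorem IsTree.eq_of_isTree_exchange [Finite V] (hT : T.IsTree) {e f : Sym2 V}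
    (he : e ∈ T.edgeSet) (hf : f ∈ T.edgeSet)
    (h : (fromEdgeSet (T.edgeSet \ {e} ∪ {f})).IsTree) : e = f := by
  by_contra hne
  have hcard := (isTree_iff_connected_and_card.mp hT).2
  have hcard' := (isTree_iff_connected_and_card.mp h).2
  rw [Nat.card_coe_set_eq] at hcard hcard'
  have hsub : (fromEdgeSet (T.edgeSet \ {e} ∪ {f})).edgeSet ⊆ T.edgeSet \ {e} := by
    rw [edgeSet_fromEdgeSet]
    rintro x ⟨hx | rfl, -⟩
    · exact hx
    · exact ⟨hf, Ne.symm hne⟩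
  have hle := Set.ncard_le_ncard hsub (Set.toFinite _)
  have hdiff := Set.ncard_sdiff_singleton_add_one he (Set.toFinite _)
  lia

end SimpleGraph


/-- **Spanning tree exchange bijection.**
If `T₁` and `T₂` are spanning trees of a finite connected simple graph `G`,
there is a bijection `σ` between their edge sets fixing common edges, such that
replacing any edge `e` of `T₁` by `σ e` again yields a spanning tree of `G`. -/
theorem spanning_tree_exchange {V : Type*} [Fintype V]
    (G : SimpleGraph V) (hG : G.Connected)
    (T₁ T₂ : SimpleGraph V) (hT₁G : T₁ ≤ G) (hT₂G : T₂ ≤ G)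
    (hT₁ : T₁.IsTree) (hT₂ : T₂.IsTree) :
    ∃ σ : T₁.edgeSet ≃ T₂.edgeSet,
      (∀ e : T₁.edgeSet, (e : Sym2 V) ∈ T₂.edgeSet → ((σ e : Sym2 V) = (e : Sym2 V))) ∧
      ∀ e : T₁.edgeSet,
        (SimpleGraph.fromEdgeSet ((T₁.edgeSet \ {(e : Sym2 V)}) ∪ {(σ e : Sym2 V)})).IsTree := by
  classical
  let r (e : T₁.edgeSet) (f : T₂.edgeSet) : Prop :=
    (SimpleGraph.fromEdgeSet (T₁.edgeSet \ {(e : Sym2 V)} ∪ {(f : Sym2 V)})).IsTree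
  have hall (A : Finset T₁.edgeSet) :
      A.card ≤ (Finset.univ.filter fun f => ∃ e ∈ A, r e f).card := by
    have h := hT₁.ncard_le_ncard_exchange hT₂ (A := Subtype.val '' (A : Set T₁.edgeSet))
      (by rintro _ ⟨e, -, rfl⟩; exact e.2)
    rw [Set.ncard_image_of_injective _ Subtype.val_injective, Set.ncard_coe_finset] at h
    rw [← Set.ncard_coe_finset (Finset.univ.filter _),
      ← Set.ncard_image_of_injective _ Subtype.val_injective]
    refine h.trans (Set.ncard_le_ncard ?_ (Set.toFinite _))
    rintro f ⟨hf, _, ⟨e, he, rfl⟩, hef⟩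
    exact ⟨⟨f, hf⟩, by simpa using ⟨e, e.2, he, hef⟩, rfl⟩
  obtain ⟨σ, hσ, hr⟩ := (Fintype.all_card_le_filter_rel_iff_exists_injective r).mp hall
  have hcard : Nat.card T₁.edgeSet = Nat.card T₂.edgeSet := by
    have h₁ := (SimpleGraph.isTree_iff_connected_and_card.mp hT₁).2
    have h₂ := (SimpleGraph.isTree_iff_connected_and_card.mp hT₂).2
    lia
  have hbij : Function.Bijective σ :=
    (Nat.bijective_iff_injective_and_card σ).mpr ⟨hσ, hcard⟩
  refine ⟨Equiv.ofBijective σ hbij, fun e he => ?_, hr⟩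
  obtain ⟨e', he'⟩ := hbij.2 ⟨e, he⟩
  have hre : r e' ⟨e, he⟩ := he' ▸ hr e'
  have heq : e' = e := Subtype.ext (hT₁.eq_of_isTree_exchange e'.2 e.2 hre)
  rw [Equiv.ofBijective_apply, ← heq, he', heq]
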